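/- Let μ ≥ μ' > 0 and z ∈ ℝ^n, and set x⁺ := p_ℓ(x,y,μ'). Then min_{i=1,…,m} [F̃_i(x⁺, μ') − F_i(z)] + κμ' ≤ min_{i=1,…,m} [F̃_i(x, μ) − F_i(z)] + κμ − (ℓ/2) · [2⟨x⁺ − y, y − x⟩ − ‖x⁺ − y‖²]. -/

import Mathlib

open scoped RealInnerProductSpace

/-- The function `φ_ℓ(·; x, y, ν)` of the subproblem, where `ftil i w ν = f̃ᵢ(w, ν)`. -/
noncomputable def phiSub (n m : ℕ) (g : Fin m → EuclideanSpace ℝ (Fin n) → ℝ)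
    (ftil : Fin m → EuclideanSpace ℝ (Fin n) → ℝ → ℝ)
    (x y : EuclideanSpace ℝ (Fin n)) (ℓ ν : ℝ) (z : EuclideanSpace ℝ (Fin n)) : ℝ :=
  (⨆ i : Fin m, (⟪gradient (fun v => ftil i v ν) y, z - y⟫ + g i z + ftil i y ν
      - (ftil i x ν + g i x))) + ℓ / 2 * ‖z - y‖ ^ 2

lemma grad_ineq_aux {E : Type*} [NormedAddCommGroup E] [InnerProductSpace ℝ E] [CompleteSpace E]
    (F : E → ℝ) (hc : ConvexOn ℝ Set.univ F) (hd : Differentiable ℝ F) (a b : E) :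
    F a + ⟪gradient F a, b - a⟫ ≤ F b := by
  have h1 : ConvexOn ℝ Set.univ (F ∘ (AffineMap.lineMap a b : ℝ →ᵃ[ℝ] E)) := by
    simpa using hc.comp_affineMap (AffineMap.lineMap a b : ℝ →ᵃ[ℝ] E)
  have h2 : HasDerivAt (F ∘ (AffineMap.lineMap a b : ℝ →ᵃ[ℝ] E)) (⟪gradient F a, b - a⟫) 0 := by
    have hg : HasFDerivAt F (InnerProductSpace.toDual ℝ E (gradient F a))
        ((AffineMap.lineMap a b : ℝ →ᵃ[ℝ] E) 0) := by
      simpa using (hd a).hasGradientAt.hasFDerivAt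
    have := hg.comp_hasDerivAt (0 : ℝ) (AffineMap.hasDerivAt_lineMap (a := a) (b := b))
    simpa using this
  have h3 := h1.le_slope_of_hasDerivAt (Set.mem_univ 0) (Set.mem_univ 1) one_pos h2
  simp only [slope_def_field, Function.comp, AffineMap.lineMap_apply_one, AffineMap.lineMap_apply_zero, sub_zero, div_one] at h3
  linarith

/-- for `μ ≥ μ' > 0`, with `x⁺ := p_ℓ(x,y,μ')` the minimizer of the
subproblem at `μ'`:
`min_i [F̃ᵢ(x⁺, μ') − Fᵢ(z)] + κμ' ≤ min_i [F̃ᵢ(x, μ) − Fᵢ(z)] + κμ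
  − (ℓ/2)[2⟨x⁺ − y, y − x⟩ − ‖x⁺ − y‖²]`. -/
theorem stmt_12 (n m : ℕ) (hn : 1 ≤ n) (hm : 1 ≤ m)
    (g f : Fin m → EuclideanSpace ℝ (Fin n) → ℝ)
    (ftil : Fin m → EuclideanSpace ℝ (Fin n) → ℝ → ℝ)
    (μ μ' ℓ κ : ℝ) (hμ' : 0 < μ') (hμμ' : μ' ≤ μ) (hℓ : 0 < ℓ) (hκ : 0 < κ)
    (hg : ∀ i, ConvexOn ℝ Set.univ (g i))
    (hfconv : ∀ i, ConvexOn ℝ Set.univ (f i))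
    (hftil : ∀ i, ∀ ν : ℝ, 0 < ν →
      ConvexOn ℝ Set.univ (fun w => ftil i w ν) ∧ ContDiff ℝ 1 (fun w => ftil i w ν))
    (hlip : ∀ i, LipschitzWith (Real.toNNReal ℓ) (fun w => gradient (fun v => ftil i v μ') w))
    (happrox : ∀ i, ∀ w, ∀ ν : ℝ, 0 < ν → |ftil i w ν - f i w| ≤ κ * ν)
    (hlipμ : ∀ i, ∀ w, ∀ ν₁ ν₂ : ℝ, 0 < ν₁ → 0 < ν₂ →
      |ftil i w ν₁ - ftil i w ν₂| ≤ κ * |ν₁ - ν₂|)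
    (x y xplus : EuclideanSpace ℝ (Fin n))
    (hmin : ∀ w : EuclideanSpace ℝ (Fin n),
      phiSub n m g ftil x y ℓ μ' xplus ≤ phiSub n m g ftil x y ℓ μ' w)
    (z : EuclideanSpace ℝ (Fin n)) :
    (⨅ i : Fin m, ((ftil i xplus μ' + g i xplus) - (f i z + g i z))) + κ * μ' ≤
      (⨅ i : Fin m, ((ftil i x μ + g i x) - (f i z + g i z))) + κ * μ
        - ℓ / 2 * (2 * ⟪xplus - y, y - x⟫ - ‖xplus - y‖ ^ 2) := by
  have hne : Nonempty (Fin m) := ⟨⟨0, hm⟩⟩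
  have hgi := fun i => grad_ineq_aux (fun w => ftil i w μ') (hftil i μ' hμ').1
    ((hftil i μ' hμ').2.differentiable (by norm_num))
  set T : Fin m → EuclideanSpace ℝ (Fin n) → ℝ := fun i w =>
    ⟪gradient (fun v => ftil i v μ') y, w - y⟫ + g i w + ftil i y μ' - (ftil i x μ' + g i x) with hT
  have hphi : ∀ w, phiSub n m g ftil x y ℓ μ' w = (⨆ i, T i w) + ℓ / 2 * ‖w - y‖ ^ 2 :=
    fun w => rfl
  have hle : ∀ i w, T i w ≤ ⨆ j, T j w := fun i w =>
    le_ciSup (f := fun j => T j w) (Set.finite_range _).bddAbove i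
  have hx0 : (⨆ i, T i x) ≤ 0 := by
    refine ciSup_le fun i => ?_
    have := hgi i y x
    simp only [hT]
    linarith
  have hcv : ∀ t : ℝ, 0 < t → t < 1 → (⨆ i, T i (xplus + t • (x - xplus))) ≤
      (1 - t) * ⨆ i, T i xplus := by
    intro t ht0 ht1
    refine ciSup_le fun i => ?_
    have e : xplus + t • (x - xplus) = (1 - t) • xplus + t • x := by module
    have h1 := (hg i).2 (Set.mem_univ xplus) (Set.mem_univ x) (by linarith : 0 ≤ 1 - t) ht0.le
      (by ring)
    rw [← e] at h1
    have e2 : xplus + t • (x - xplus) - y = (1 - t) • (xplus - y) + t • (x - y) := by module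
    have h2 : T i (xplus + t • (x - xplus)) ≤ (1 - t) * T i xplus + t * T i x := by
      simp only [hT, e2, inner_add_right, inner_smul_right]
      simp only [smul_eq_mul] at h1
      linarith
    have h3 := mul_le_mul_of_nonneg_left (hle i xplus) (by linarith : 0 ≤ 1 - t)
    have h4 := mul_le_mul_of_nonneg_left ((hle i x).trans hx0) ht0.le
    linarith
  have hkey : (⨆ i, T i xplus) ≤ ℓ * ⟪xplus - y, x - xplus⟫ := by
    have hq : ∀ t : ℝ, 0 < t → t < 1 → (⨆ i, T i xplus) ≤
        ℓ * ⟪xplus - y, x - xplus⟫ + t * (ℓ / 2 * ‖x - xplus‖ ^ 2) := by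
      intro t ht0 ht1
      have h1 := hmin (xplus + t • (x - xplus))
      rw [hphi, hphi] at h1
      have e : xplus + t • (x - xplus) - y = (xplus - y) + t • (x - xplus) := by module
      rw [e, norm_add_sq_real, inner_smul_right, norm_smul, mul_pow, Real.norm_eq_abs, sq_abs] at h1
      have h2 := hcv t ht0 ht1
      refine le_of_mul_le_mul_left ?_ ht0
      nlinarith
    have hlim : Filter.Tendsto (fun t : ℝ => ℓ * ⟪xplus - y, x - xplus⟫ +
        t * (ℓ / 2 * ‖x - xplus‖ ^ 2)) (nhdsWithin 0 (Set.Ioi 0))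
        (nhds (ℓ * ⟪xplus - y, x - xplus⟫)) := by
      have : Continuous (fun t : ℝ => ℓ * ⟪xplus - y, x - xplus⟫ +
        t * (ℓ / 2 * ‖x - xplus‖ ^ 2)) := by fun_prop
      have h := this.tendsto 0
      simp only [zero_mul, add_zero] at h
      exact h.mono_left nhdsWithin_le_nhds
    refine ge_of_tendsto hlim ?_
    filter_upwards [Ioo_mem_nhdsGT (zero_lt_one (α := ℝ))] with t ht
    exact hq t ht.1 ht.2
  have hdesc : ∀ i, ftil i xplus μ' ≤ ftil i y μ' +
      ⟪gradient (fun v => ftil i v μ') y, xplus - y⟫ + ℓ * ‖xplus - y‖ ^ 2 := by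
    intro i
    have h1 := hgi i xplus y
    have h2 := (hlip i).dist_le_mul xplus y
    rw [dist_eq_norm, dist_eq_norm, Real.coe_toNNReal _ hℓ.le] at h2
    have h3 := real_inner_le_norm (gradient (fun v => ftil i v μ') xplus -
      gradient (fun v => ftil i v μ') y) (xplus - y)
    have h4 := mul_le_mul_of_nonneg_right h2 (norm_nonneg (xplus - y))
    rw [inner_sub_left] at h3
    rw [← neg_sub xplus y, inner_neg_right] at h1
    nlinarith
  have e3 : ⟪xplus - y, x - xplus⟫ = - ⟪xplus - y, y - x⟫ - ‖xplus - y‖ ^ 2 := by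
    have : x - xplus = -(y - x) - (xplus - y) := by module
    rw [this, inner_sub_right, inner_neg_right, real_inner_self_eq_norm_sq]
  have hfin : ∀ i, ftil i xplus μ' + g i xplus ≤ ftil i x μ' + g i x
      - ℓ * ⟪xplus - y, y - x⟫ := by
    intro i
    have h1 := (hle i xplus).trans hkey
    rw [e3] at h1
    have h2 := hdesc i
    simp only [hT] at h1
    linarith
  have hsq : 0 ≤ ℓ / 2 * ‖xplus - y‖ ^ 2 := by positivity
  have hgoal : (⨅ i : Fin m, ((ftil i xplus μ' + g i xplus) - (f i z + g i z))) + κ * μ' - κ * μ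
        + ℓ / 2 * (2 * ⟪xplus - y, y - x⟫ - ‖xplus - y‖ ^ 2) ≤
      (⨅ i : Fin m, ((ftil i x μ + g i x) - (f i z + g i z))) := by
    refine le_ciInf fun i => ?_
    have h1 := ciInf_le (f := fun i : Fin m => (ftil i xplus μ' + g i xplus) - (f i z + g i z))
      (Set.finite_range _).bddBelow i
    have h2 := hfin i
    have h3 := (abs_le.1 (hlipμ i x μ' μ hμ' (by linarith))).2
    rw [abs_of_nonpos (by linarith)] at h3
    linarith
  linarith
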